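/- Let p be an odd prime and 0 < ε < 1/5. If n is at least an exponential tower of p's of height ⌊log₂(1/ε)⌋ + 5 with a ⌈1/ε⌉ on top (T(0) = ⌈1/ε⌉, T(k+1) = p^{T(k)}, n ≥ T(⌊log₂(1/ε)⌋ + 5)), then for every subset A ⊆ 𝔽_p^n with density α = |A|/p^n there exists a nonzero d ∈ 𝔽_p^n such that the density of 3-APs with common difference d of A is at least α³ − ε. -/

import Mathlib

/-- A tower of `p`'s of height `h` with `t` on top: `T 0 = t`, `T (k+1) = p ^ T k`. -/
def towerTop (p t : ℕ) : ℕ → ℕ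
  | 0 => t
  | k + 1 => p ^ towerTop p t k

section
open Finset
open scoped Classical

section
variable {G : Type*} [AddCommGroup G] [Fintype G]

noncomputable def fc (u : G → ℝ) (χ : AddChar G ℂ) : ℂ := ∑ x, (u x : ℂ) * χ x

noncomputable def ag (K : AddSubgroup G) (u : G → ℝ) (x : G) : ℝ :=
  (∑ k : K, u (x + k)) / (Nat.card K : ℝ)

lemma pair_sum (φ ψ : G → ℝ) : ∑ x, ∑ d, φ x * ψ (x + d) = (∑ x, φ x) * ∑ x, ψ x := by
  rw [Finset.sum_mul]
  refine Finset.sum_congr rfl fun x _ => ?_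
  rw [← Finset.mul_sum]
  congr 1
  exact Equiv.sum_comp (Equiv.addLeft x) ψ

lemma schur_ineq (a b c : ℝ) (ha : 0 ≤ a) (hb : 0 ≤ b) (hc : 0 ≤ c) :
    a^2*b + a^2*c + b^2*a+b^2*c+c^2*a+c^2*b ≤ a^3+b^3+c^3+(a*b*c+a*b*c+a*b*c) := by
  rcases le_total a b with h1 | h1 <;> rcases le_total b c with h2 | h2 <;>
  rcases le_total a c with h3 | h3 <;>
  nlinarith [mul_nonneg (sub_nonneg.2 h1) (sub_nonneg.2 h2), mul_nonneg (sub_nonneg.2 h1) (sub_nonneg.2 h3), mul_nonneg (sub_nonneg.2 h3) (sub_nonneg.2 h2), mul_nonneg ha (sq_nonneg (a-b)), mul_nonneg hb (sq_nonneg (b-c)), mul_nonneg hc (sq_nonneg (c-a)), mul_nonneg ha (sq_nonneg (a-c)), mul_nonneg hb (sq_nonneg (b-a)), mul_nonneg hc (sq_nonneg (c-b)),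
   mul_nonneg (mul_nonneg (sub_nonneg.2 h1) (sub_nonneg.2 h2)) ha, mul_nonneg (mul_nonneg (sub_nonneg.2 h1) (sub_nonneg.2 h2)) hb, mul_nonneg (mul_nonneg (sub_nonneg.2 h1) (sub_nonneg.2 h2)) hc,
   mul_nonneg (mul_nonneg (sub_nonneg.2 h1) (sub_nonneg.2 h3)) ha, mul_nonneg (mul_nonneg (sub_nonneg.2 h1) (sub_nonneg.2 h3)) hb, mul_nonneg (mul_nonneg (sub_nonneg.2 h1) (sub_nonneg.2 h3)) hc,
   mul_nonneg (mul_nonneg (sub_nonneg.2 h3) (sub_nonneg.2 h2)) ha, mul_nonneg (mul_nonneg (sub_nonneg.2 h3) (sub_nonneg.2 h2)) hb, mul_nonneg (mul_nonneg (sub_nonneg.2 h3) (sub_nonneg.2 h2)) hc,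
   mul_nonneg (sub_nonneg.2 h1) (sq_nonneg (a-b)), mul_nonneg (sub_nonneg.2 h2) (sq_nonneg (b-c)), mul_nonneg (sub_nonneg.2 h3) (sq_nonneg (a-c))]

noncomputable def L3 (u : G → ℝ) : ℝ := ∑ x, ∑ d, u x * u (x + d) * u (x + (d + d))

lemma schur_sum (hb : Function.Bijective (fun d : G => d + d)) (w : G → ℝ) (hw : ∀ x, 0 ≤ w x) :
    2 * (∑ x, w x) ^ 3 / (Fintype.card G : ℝ) - (Fintype.card G : ℝ) * ∑ x, w x ^ 3 ≤ L3 w := by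
  have key : ∀ φ ψ : G → ℝ, (∑ x, ∑ d, φ x * ψ (x + d) = (∑ x, φ x) * ∑ x, ψ x) ∧
     (∑ x, ∑ d, φ x * ψ (x + (d + d)) = (∑ x, φ x) * ∑ x, ψ x) ∧
     (∑ x, ∑ d, φ (x + d) * ψ (x + (d + d)) = (∑ x, φ x) * ∑ x, ψ x) := by
    intro φ ψ
    refine ⟨pair_sum φ ψ, ?_, ?_⟩
    · rw [← pair_sum φ ψ]
      refine Finset.sum_congr rfl fun x _ => ?_
      exact (Equiv.ofBijective _ hb).sum_comp (fun d => φ x * ψ (x + d))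
    · rw [← pair_sum φ ψ, Finset.sum_comm, Finset.sum_comm (f := fun x d => φ x * ψ (x + d))]
      refine Finset.sum_congr rfl fun d _ => ?_
      rw [← Equiv.sum_comp (Equiv.addRight d) (fun x => φ x * ψ (x + d))]
      simp [add_assoc]
  have h := Finset.sum_le_sum (s := univ) fun x (_ : x ∈ univ) =>
    Finset.sum_le_sum (s := univ) fun d (_ : d ∈ univ) =>
      schur_ineq (w x) (w (x + d)) (w (x + (d + d))) (hw _) (hw _) (hw _)
  have s1 := key (fun x => w x ^ 2) w
  have s2 := key w (fun x => w x ^ 2)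
  have s3 := key (fun x => w x ^ 3) (fun _ => 1)
  have s4 := key (fun _ => 1) (fun x => w x ^ 3)
  simp only [Finset.sum_add_distrib] at h
  have c1 : ∀ x d, w (x+d)^2 * w x = w x * w (x+d)^2 := fun _ _ => mul_comm _ _
  have c2 : ∀ x d, w (x+(d+d))^2 * w x = w x * w (x+(d+d))^2 := fun _ _ => mul_comm _ _
  have c3 : ∀ x d, w (x+(d+d))^2 * w (x+d) = w (x+d) * w (x+(d+d))^2 := fun _ _ => mul_comm _ _
  simp only [mul_one, one_mul] at s3 s4
  simp only [c1, c3, s1, s2, s3, s4] at h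
  have hN : (0:ℝ) < Fintype.card G := by exact_mod_cast Fintype.card_pos
  have cs : (∑ x, w x) ^ 2 ≤ Fintype.card G * ∑ x, w x ^ 2 := by
    simpa using sq_sum_le_card_mul_sum_sq (s := (univ : Finset G)) (f := w)
  have hS : 0 ≤ ∑ x, w x := Finset.sum_nonneg fun x _ => hw x
  have : 2 * (∑ x, w x) ^ 3 / (Fintype.card G : ℝ) ≤ 2 * ((∑ x, w x) * ∑ x, w x ^ 2) := by
    rw [div_le_iff₀ hN]
    nlinarith [mul_le_mul_of_nonneg_left cs hS]
  unfold L3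
  simp only [Finset.sum_const, Finset.card_univ, nsmul_eq_mul, mul_one] at h
  linarith

lemma L3_fourier (u : G → ℝ) : ((Fintype.card G : ℝ) * L3 u : ℂ) =
    ∑ χ : AddChar G ℂ, fc u χ ^ 2 * fc u (χ * χ)⁻¹ := by
  have h1 : ∀ χ : AddChar G ℂ, fc u χ ^ 2 * fc u (χ * χ)⁻¹ =
      ∑ a, ∑ b, ∑ c, ((u a * u b * u c : ℝ) : ℂ) * χ (a + c - (b + b)) := by
    intro χ
    have : fc u (χ * χ)⁻¹ = ∑ x, (u x : ℂ) * χ (-(x + x)) := by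
      unfold fc
      refine Finset.sum_congr rfl fun x _ => ?_
      rw [AddChar.inv_apply, AddChar.mul_apply, ← AddChar.map_add_eq_mul]
      congr 2; abel
    rw [this, pow_two]
    unfold fc
    rw [mul_assoc, Finset.sum_mul]
    refine Finset.sum_congr rfl fun a _ => ?_
    rw [mul_comm (∑ x, (u x : ℂ) * χ x), Finset.sum_mul, Finset.mul_sum]
    refine Finset.sum_congr rfl fun b _ => ?_
    rw [Finset.mul_sum, Finset.mul_sum]
    refine Finset.sum_congr rfl fun c _ => ?_
    rw [sub_eq_add_neg, AddChar.map_add_eq_mul, AddChar.map_add_eq_mul]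
    push_cast; ring
  simp_rw [h1]
  rw [Finset.sum_comm]
  unfold L3
  push_cast
  rw [Finset.mul_sum]
  refine Finset.sum_congr rfl fun a _ => ?_
  rw [Finset.sum_comm, Finset.mul_sum, ← Equiv.sum_comp (Equiv.addLeft a) (fun y => ∑ χ : AddChar G ℂ, _)]
  refine Finset.sum_congr rfl fun d _ => ?_
  rw [Finset.sum_comm]
  simp_rw [← Finset.mul_sum, AddChar.sum_apply_eq_ite]
  rw [Finset.sum_eq_single (a + (d + d))]
  · rw [if_pos]
    · simp; ring
    · show a + (a + (d + d)) - ((a + d) + (a + d)) = 0; abel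
  · intro c _ hc
    rw [if_neg, mul_zero]
    intro h
    apply hc
    rw [Equiv.coe_addLeft] at h
    have : c = (a + c - (a + d + (a + d))) + (a + (d + d)) := by abel
    rw [this, h, zero_add]
  · simp

lemma parseval (u : G → ℝ) : ∑ χ : AddChar G ℂ, ‖fc u χ‖ ^ 2 =
    (Fintype.card G : ℝ) * ∑ x, u x ^ 2 := by
  have h1 : ∀ χ : AddChar G ℂ, ((‖fc u χ‖ ^ 2 : ℝ) : ℂ) =
      ∑ a, ∑ b, ((u a * u b : ℝ) : ℂ) * χ (a - b) := by
    intro χ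
    push_cast
    rw [← Complex.mul_conj']
    unfold fc
    rw [map_sum, Finset.sum_mul]
    refine Finset.sum_congr rfl fun a _ => ?_
    rw [Finset.mul_sum]
    refine Finset.sum_congr rfl fun b _ => ?_
    rw [sub_eq_add_neg, AddChar.map_add_eq_mul, AddChar.map_neg_eq_conj, map_mul, Complex.conj_ofReal]
    push_cast; ring
  have : ((∑ χ : AddChar G ℂ, ‖fc u χ‖ ^ 2 : ℝ) : ℂ) =
    (((Fintype.card G : ℝ) * ∑ x, u x ^ 2 : ℝ) : ℂ) := by
    rw [Complex.ofReal_sum]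
    simp_rw [h1]
    rw [Finset.sum_comm]
    push_cast
    rw [Finset.mul_sum]
    refine Finset.sum_congr rfl fun a _ => ?_
    rw [Finset.sum_comm]
    simp_rw [← Finset.mul_sum, AddChar.sum_apply_eq_ite]
    rw [Finset.sum_eq_single a]
    · simp; ring
    · intro c _ hc
      rw [if_neg, mul_zero]
      intro h
      exact hc (sub_eq_zero.1 h).symm
    · simp
  exact_mod_cast this

lemma fc_shift (u : G → ℝ) (k : G) (χ : AddChar G ℂ) :
    fc (fun x => u (x + k)) χ = fc u χ * χ (-k) := by
  unfold fc
  rw [← (Equiv.subRight k).sum_comp, Finset.sum_mul]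
  refine Finset.sum_congr rfl fun x _ => ?_
  simp [sub_eq_add_neg, AddChar.map_add_eq_mul, mul_assoc]

lemma fc_ag (K : AddSubgroup G) (u : G → ℝ) (χ : AddChar G ℂ) :
    fc (ag K u) χ = if (∀ k ∈ K, χ k = 1) then fc u χ else 0 := by
  have h1 : fc (ag K u) χ = (∑ k : K, fc (fun x => u (x + k)) χ) / (Nat.card K : ℂ) := by
    unfold fc ag
    rw [Finset.sum_comm, Finset.sum_div]
    refine Finset.sum_congr rfl fun x _ => ?_
    push_cast
    rw [← Finset.sum_mul]
    ring
  have hK : (Nat.card K : ℂ) ≠ 0 := by exact_mod_cast Nat.card_pos.ne'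
  rw [h1]
  simp_rw [fc_shift]
  rw [← Finset.mul_sum]
  split_ifs with h
  · rw [Finset.sum_congr rfl (g := fun _ => (1:ℂ)) fun k _ => h _ (K.neg_mem k.2)]
    simp at hK ⊢
    try field_simp
  · have : ∑ k : K, χ (-(k:G)) = 0 := by
      push Not at h
      obtain ⟨k, hk, hk1⟩ := h
      have e : ∑ k : K, χ (-(k:G)) = χ k * ∑ k : K, χ (-(k:G)) := by
        rw [Finset.mul_sum, ← (Equiv.subRight (⟨k, hk⟩ : K)).sum_comp]
        refine Finset.sum_congr rfl fun x _ => ?_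
        rw [← AddChar.map_add_eq_mul]
        congr 1; simp; abel
      have : (χ k - 1) * ∑ k : K, χ (-(k:G)) = 0 := by rw [sub_mul, ← e]; ring
      rcases mul_eq_zero.1 this with h | h
      · exact absurd (sub_eq_zero.1 h) hk1
      · exact h
    rw [this]; simp

lemma sum_ag (K : AddSubgroup G) (u : G → ℝ) : ∑ x, ag K u x = ∑ x, u x := by
  unfold ag
  rw [← Finset.sum_div, Finset.sum_comm]
  have : ∀ k : K, ∑ x, u (x + k) = ∑ x, u x := fun k => Equiv.sum_comp (Equiv.addRight (k:G)) u
  simp_rw [this]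
  have hK : (Nat.card K : ℝ) ≠ 0 := by exact_mod_cast Nat.card_pos.ne'
  simp at hK ⊢

lemma ag_nonneg (K : AddSubgroup G) (u : G → ℝ) (hu : ∀ x, 0 ≤ u x) (x) : 0 ≤ ag K u x :=
  div_nonneg (Finset.sum_nonneg fun _ _ => hu _) (Nat.cast_nonneg _)

lemma ag_le (K : AddSubgroup G) (u : G → ℝ) (hu : ∀ x, u x ≤ 1) (x) : ag K u x ≤ 1 := by
  unfold ag
  have hK : (0:ℝ) < (Nat.card K : ℝ) := by exact_mod_cast Nat.card_pos
  rw [div_le_one hK]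
  refine (Finset.sum_le_sum fun k _ => hu _).trans ?_
  simp

lemma core (hb : Function.Bijective (fun d : G => d + d)) (u : G → ℝ) (hu : ∀ x, 0 ≤ u x)
    (hu1 : ∀ x, u x ≤ 1) (K : AddSubgroup G) (δ : ℝ) (hδ : 0 ≤ δ)
    (hK : ∀ χ : AddChar G ℂ, δ * Fintype.card G < ‖fc u χ‖ → ∀ k ∈ K, χ k = 1) :
    2 * (∑ x, u x) ^ 3 / (Fintype.card G : ℝ) - (Fintype.card G : ℝ) * ∑ x, ag K u x ^ 3
      - δ * (Fintype.card G : ℝ) ^ 2 ≤ L3 u := by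
  classical
  have hN : (0:ℝ) < Fintype.card G := by exact_mod_cast Fintype.card_pos
  have h1 := schur_sum hb (ag K u) (ag_nonneg K u hu)
  rw [sum_ag] at h1
  have hodd : ∀ χ : AddChar G ℂ, (∀ k ∈ K, (χ * χ)⁻¹ k = 1) ↔ (∀ k ∈ K, χ k = 1) := by
    intro χ
    have hbK : Function.Bijective (fun d : K => d + d) := by
      rw [← Finite.injective_iff_bijective]
      intro a b h
      apply Subtype.ext
      apply hb.1
      simpa using congrArg (Subtype.val) h
    constructor
    · intro h k hk
      obtain ⟨⟨d, hd⟩, e⟩ := hbK.2 ⟨k, hk⟩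
      have e : d + d = k := congrArg Subtype.val e
      have := h (-d) (K.neg_mem hd)
      rw [AddChar.inv_apply, AddChar.mul_apply, neg_neg, ← AddChar.map_add_eq_mul, e] at this
      exact this
    · intro h k hk
      rw [AddChar.inv_apply, AddChar.mul_apply, h _ (K.neg_mem hk), one_mul]
  have h2 : ‖(((Fintype.card G : ℝ) * L3 u - (Fintype.card G : ℝ) * L3 (ag K u) : ℝ) : ℂ)‖ ≤
      δ * (Fintype.card G) ^ 3 := by
    push_cast
    have e1 := L3_fourier u
    have e2 := L3_fourier (ag K u)
    push_cast at e1 e2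
    rw [e1, e2, ← Finset.sum_sub_distrib]
    refine (norm_sum_le _ _).trans ?_
    have : ∀ χ : AddChar G ℂ, ‖fc u χ ^ 2 * fc u (χ * χ)⁻¹ - fc (ag K u) χ ^ 2 * fc (ag K u) (χ * χ)⁻¹‖
      ≤ (δ * Fintype.card G) * ‖fc u χ‖ ^ 2 := by
      intro χ
      rw [fc_ag, fc_ag]
      by_cases h : ∀ k ∈ K, χ k = 1
      · rw [if_pos h, if_pos ((hodd χ).2 h)]
        simp; positivity
      · rw [if_neg h]
        have h' := fun hh => h ((hodd χ).1 (hK _ hh))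
        replace h' := not_lt.1 h'
        simp only [ne_eq, OfNat.ofNat_ne_zero, not_false_eq_true, zero_pow, zero_mul, sub_zero,
          norm_mul, norm_pow]
        rw [mul_comm]
        exact mul_le_mul_of_nonneg_right h' (by positivity)
    refine (Finset.sum_le_sum fun χ _ => this χ).trans ?_
    rw [← Finset.mul_sum, parseval]
    have : ∑ x, u x ^ 2 ≤ Fintype.card G := by
      refine (Finset.sum_le_sum (g := fun _ => (1:ℝ)) fun x _ => ?_).trans ?_
      · exact pow_le_one₀ (hu x) (hu1 x)
      · simp
    calc _ = δ * (Fintype.card G : ℝ)^2 * ∑ x, u x ^ 2 := by ring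
      _ ≤ δ * (Fintype.card G : ℝ)^2 * Fintype.card G := by gcongr
      _ = _ := by ring
  rw [Complex.norm_real, Real.norm_eq_abs, ← mul_sub, abs_mul, abs_of_pos hN] at h2
  have h3 : |L3 u - L3 (ag K u)| ≤ δ * (Fintype.card G : ℝ) ^ 2 := by
    refine le_of_mul_le_mul_left (h2.trans_eq ?_) hN
    ring
  have := (abs_le.1 h3).1
  linarith
end
section
variable {G : Type*} [AddCommGroup G] [Fintype G]

lemma spec_card (u : G → ℝ) (hu : ∀ x, 0 ≤ u x) (hu1 : ∀ x, u x ≤ 1) (δ : ℝ) (hδ : 0 < δ) (m : ℕ)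
    (hm : 1 ≤ m * δ ^ 2) :
    (univ.filter fun χ : AddChar G ℂ => δ * Fintype.card G < ‖fc u χ‖).card ≤ m := by
  have hN : (0:ℝ) < Fintype.card G := by exact_mod_cast Fintype.card_pos
  have h2 : ∑ x, u x ^ 2 ≤ Fintype.card G := by
    refine (Finset.sum_le_sum (g := fun _ => (1:ℝ)) fun x _ => ?_).trans ?_
    · exact pow_le_one₀ (hu x) (hu1 x)
    · simp
  set T := univ.filter fun χ : AddChar G ℂ => δ * Fintype.card G < ‖fc u χ‖ with hT
  have h3 : (T.card : ℝ) * (δ * Fintype.card G) ^ 2 ≤ (Fintype.card G : ℝ) * Fintype.card G := by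
    calc (T.card : ℝ) * (δ * Fintype.card G) ^ 2 = ∑ χ ∈ T, (δ * Fintype.card G) ^ 2 := by simp
      _ ≤ ∑ χ ∈ T, ‖fc u χ‖ ^ 2 := by
        refine Finset.sum_le_sum fun χ hχ => ?_
        have := (Finset.mem_filter.1 hχ).2
        exact pow_le_pow_left₀ (by positivity) this.le 2
      _ ≤ ∑ χ, ‖fc u χ‖ ^ 2 :=
        Finset.sum_le_sum_of_subset_of_nonneg (Finset.subset_univ _) fun _ _ _ => by positivity
      _ = _ := parseval u
      _ ≤ _ := by gcongr
  have h4 : (T.card : ℝ) * δ ^ 2 ≤ m * δ ^ 2 := by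
    refine le_trans ?_ hm
    refine le_of_mul_le_mul_right ?_ (mul_pos hN hN)
    linarith
  exact_mod_cast le_of_mul_le_mul_right h4 (by positivity)

/-- common kernel -/
def ck (S : Finset (AddChar G ℂ)) : AddSubgroup G where
  carrier := {g | ∀ χ ∈ S, χ g = 1}
  zero_mem' := by intro χ _; simp
  add_mem' := by
    intro a b ha hb χ hχ
    rw [AddChar.map_add_eq_mul, ha χ hχ, hb χ hχ, one_mul]
  neg_mem' := by
    intro a ha χ hχ
    rw [AddChar.map_neg_eq_inv, ha χ hχ, inv_one]

lemma ck_index (p : ℕ) (hp : 0 < p) (hG : ∀ g : G, p • g = 0) (S : Finset (AddChar G ℂ)) :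
    (ck S).index ≤ p ^ S.card := by
  let φ : G → (S → Polynomial.nthRootsFinset p (1:ℂ)) := fun g χ => ⟨χ.1 g, by
    rw [Polynomial.mem_nthRootsFinset hp, ← AddChar.map_nsmul_eq_pow, hG, AddChar.map_zero_eq_one]⟩
  have hinj : Function.Injective (fun q : G ⧸ ck S => φ q.out) := by
    intro q q' h
    rw [← q.out_eq', ← q'.out_eq']
    apply QuotientAddGroup.eq.2
    intro χ hχ
    have : χ q.out = χ q'.out := congrArg Subtype.val (congrFun h ⟨χ, hχ⟩)
    rw [AddChar.map_add_eq_mul, ← this, ← AddChar.map_add_eq_mul, neg_add_cancel,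
      AddChar.map_zero_eq_one]
  have h1 := Nat.card_le_card_of_injective _ hinj
  refine h1.trans ?_
  rw [Nat.card_fun, Nat.card_eq_fintype_card, Nat.card_eq_fintype_card, Fintype.card_coe,
    Fintype.card_coe]
  refine Nat.pow_le_pow_left ?_ _
  unfold Polynomial.nthRootsFinset
  exact (Multiset.toFinset_card_le _).trans (Polynomial.card_nthRoots p 1)
end

section
variable {V : Type*} [AddCommGroup V] [Fintype V]

lemma step (p : ℕ) (hp : 0 < p) (hV : ∀ g : V, p • g = 0)
    (hb : Function.Injective (fun d : V => d + d)) (f : V → ℝ) (hf : ∀ x, 0 ≤ f x)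
    (hf1 : ∀ x, f x ≤ 1) (δ : ℝ) (hδ : 0 < δ) (m : ℕ) (hm : 1 ≤ m * δ ^ 2) (H : AddSubgroup V) :
    ∃ H' : AddSubgroup V, H'.index ≤ H.index * p ^ (H.index * m) ∧
      (Nat.card H : ℝ) * (2 * ∑ x, ag H f x ^ 3 - ∑ x, ag H' f x ^ 3 - δ * Fintype.card V) ≤
        ∑ x, ∑ d : H, f x * f (x + d) * f (x + (d + d)) := by
  have hbH : Function.Bijective (fun d : H => d + d) := by
    rw [← Finite.injective_iff_bijective]
    intro a b h
    apply Subtype.ext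
    apply hb
    simpa using congrArg (Subtype.val) h
  let F : V → H → ℝ := fun x h => f (x + h)
  let T : V → Finset (AddChar H ℂ) := fun x =>
    univ.filter fun χ : AddChar H ℂ => δ * Fintype.card H < ‖fc (F x) χ‖
  let S : Finset (AddChar H ℂ) := univ.biUnion fun q : V ⧸ H => T q.out
  have hS : S.card ≤ H.index * m := by
    refine (Finset.card_biUnion_le_card_mul _ _ m fun q _ => ?_).trans ?_
    · exact spec_card _ (fun _ => hf _) (fun _ => hf1 _) δ hδ m hm
    · rw [Finset.card_univ, AddSubgroup.index, Nat.card_eq_fintype_card]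
  have hTS : ∀ x, T x ⊆ S := by
    intro x χ hχ
    refine Finset.mem_biUnion.2 ⟨(x : V ⧸ H), Finset.mem_univ _, ?_⟩
    obtain ⟨h, hh⟩ := QuotientAddGroup.mk_out_eq_add H x
    rw [hh]
    have hF : F (x + h) = fun y => F x (y + h) := by
      funext y
      simp only [F]
      congr 1
      push_cast; abel
    have := (Finset.mem_filter.1 hχ).2
    refine Finset.mem_filter.2 ⟨Finset.mem_univ _, ?_⟩
    rw [hF, fc_shift, norm_mul, AddChar.norm_apply, mul_one]
    exact this
  let K := ck S
  have hKi : K.index ≤ p ^ (H.index * m) :=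
    (ck_index p hp (fun g => by apply Subtype.ext; simpa using hV g) S).trans
      (Nat.pow_le_pow_right hp hS)
  refine ⟨K.map H.subtype, ?_, ?_⟩
  · rw [AddSubgroup.index_map_subtype, mul_comm]
    exact Nat.mul_le_mul_left _ hKi
  · have hag : ∀ x (h : H), ag K (F x) h = ag (K.map H.subtype) f (x + h) := by
      intro x h
      unfold ag
      let e := (K.equivMapOfInjective H.subtype H.subtype_injective).toEquiv
      rw [Nat.card_congr e, ← Equiv.sum_comp e]
      congr 1
      refine Finset.sum_congr rfl fun k _ => ?_
      simp [F, e, add_assoc]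
    have hc := fun x => core hbH (F x) (fun _ => hf _) (fun _ => hf1 _) K δ hδ.le (by
      intro χ hχ k hk
      exact hk χ (hTS x (Finset.mem_filter.2 ⟨Finset.mem_univ _, hχ⟩)))
    have hsum := Finset.sum_le_sum fun x (_ : x ∈ (univ : Finset V)) => hc x
    have hshift : ∀ φ : V → ℝ, ∑ x, ∑ h : H, φ (x + h) = (Fintype.card H : ℝ) * ∑ x, φ x := by
      intro φ
      rw [Finset.sum_comm]
      have : ∀ h : H, ∑ x, φ (x + h) = ∑ x, φ x := fun k => Equiv.sum_comp (Equiv.addRight (k:V)) φ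
      simp_rw [this]
      simp
    have hN : (0:ℝ) < Fintype.card H := by exact_mod_cast Fintype.card_pos
    have e1 : ∑ x, L3 (F x) = (Fintype.card H : ℝ) *
        ∑ x, ∑ d : H, f x * f (x + d) * f (x + (d + d)) := by
      rw [← hshift]
      refine Finset.sum_congr rfl fun x _ => Finset.sum_congr rfl fun h _ =>
        Finset.sum_congr rfl fun d _ => ?_
      simp [F, add_assoc]
    have e2 : ∀ x, 2 * (∑ h, F x h) ^ 3 / (Fintype.card H : ℝ) =
        2 * (Fintype.card H : ℝ) ^ 2 * ag H f x ^ 3 := by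
      intro x
      unfold ag
      rw [Nat.card_eq_fintype_card]
      field_simp
      rfl
    rw [e1] at hsum
    simp_rw [hag, e2, Finset.sum_sub_distrib, ← Finset.mul_sum] at hsum
    rw [hshift (fun x => ag (K.map H.subtype) f x ^ 3)] at hsum
    rw [Nat.card_eq_fintype_card]
    refine le_of_mul_le_mul_left (le_trans (le_of_eq ?_) hsum) hN
    simp
    ring

end

end

section
open Finset

lemma tower_mono (p t : ℕ) (hp : 1 < p) : Monotone (towerTop p t) :=
  monotone_nat_of_le_succ fun _ => (Nat.lt_pow_self hp).le

lemma two_mul_le_pow (p : ℕ) (hp : 3 ≤ p) (a : ℕ) : 2 * a ≤ p ^ a := by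
  have h : 2 * a ≤ 3 ^ a := by
    induction a with
    | zero => simp
    | succ k ih =>
      rw [pow_succ]
      have : 1 ≤ 3 ^ k := Nat.one_le_pow _ _ (by norm_num)
      omega
  exact h.trans (Nat.pow_le_pow_left hp a)

lemma base_tower (p t : ℕ) (hp : 3 ≤ p) (ht : 5 ≤ t) : 32 * t ^ 2 ≤ towerTop p t 2 := by
  show 32 * t ^ 2 ≤ p ^ (p ^ t)
  have h1 : 2 * t + 1 ≤ 3 ^ t := by
    clear ht
    induction t with
    | zero => simp
    | succ k ih => rw [pow_succ]; omega
  have h2 : 2 * t + 1 ≤ p ^ t := h1.trans (Nat.pow_le_pow_left hp t)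
  have h3 : 3 ^ (2 * t + 1) ≤ p ^ (p ^ t) :=
    (Nat.pow_le_pow_right (by norm_num) h2).trans (Nat.pow_le_pow_left hp _)
  refine le_trans ?_ h3
  have h4 : ∀ s : ℕ, 5 ≤ s → 32 * s ^ 2 ≤ 3 ^ (2 * s + 1) := by
    intro s hs
    induction s, hs using Nat.le_induction with
    | base => norm_num
    | succ k hk ih =>
      have : 3 ^ (2 * (k + 1) + 1) = 9 * 3 ^ (2 * k + 1) := by ring
      rw [this]
      nlinarith
  exact h4 t ht

section
open scoped Classical

lemma sum_D {V : Type*} [AddCommGroup V] [Fintype V] (D : V → ℝ) (H : AddSubgroup V) (N c : ℝ)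
    (h0 : D 0 ≤ N) (hN : 0 ≤ N) (hc : -1 ≤ c) (hD : ∀ d, d ≠ 0 → D d ≤ N * c) :
    ∑ d : H, D d ≤ (Nat.card H : ℝ) * (N * c) + 2 * N := by
  have h : ∀ d : H, D d ≤ N * c + if d = 0 then 2 * N else 0 := by
    intro d
    split_ifs with hd
    · subst hd
      have : D ((0 : H) : V) = D 0 := by simp
      rw [this]; nlinarith
    · rw [add_zero]
      exact hD _ (by simpa using hd)
  refine (Finset.sum_le_sum fun d _ => h d).trans ?_
  rw [Finset.sum_add_distrib]
  simp

lemma main_aux {V : Type*} [AddCommGroup V] [Fintype V] (p : ℕ) (hp : 3 ≤ p)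
    (hV : ∀ g : V, p • g = 0)
    (hb : Function.Injective (fun d : V => d + d)) (f : V → ℝ) (hf : ∀ x, 0 ≤ f x)
    (hf1 : ∀ x, f x ≤ 1) (ε : ℝ) (hε0 : 0 < ε) (hε : ε < 1 / 5) (α : ℝ)
    (hα : ∑ x, f x = Fintype.card V * α)
    (hn : towerTop p ⌈1 / ε⌉₊ (⌊Real.logb 2 (1 / ε)⌋₊ + 5) ≤ Fintype.card V) :
    ∃ d : V, d ≠ 0 ∧
      Fintype.card V * (α ^ 3 - ε) ≤ ∑ x, f x * f (x + d) * f (x + (d + d)) := by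
  by_contra! hcon
  set t := ⌈1 / ε⌉₊ with ht
  set l := ⌊Real.logb 2 (1 / ε)⌋₊ with hl
  have hN : (0:ℝ) < Fintype.card V := by exact_mod_cast Fintype.card_pos
  have hte : 1 ≤ t * ε := by
    have := Nat.le_ceil (1 / ε)
    rwa [div_le_iff₀ hε0] at this
  have ht1 : 5 ≤ t := by
    have : (5:ℝ) ≤ t := by
      by_contra! h
      nlinarith
    exact_mod_cast this
  have hα0 : 0 ≤ α := by
    have : 0 ≤ (Fintype.card V : ℝ) * α := hα ▸ Finset.sum_nonneg fun x _ => hf x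
    exact nonneg_of_mul_nonneg_right this hN
  have hα1 : α ≤ 1 := by
    have : (Fintype.card V : ℝ) * α ≤ Fintype.card V * 1 := by
      rw [← hα]
      refine (Finset.sum_le_sum fun x _ => hf1 x).trans ?_
      simp
    exact le_of_mul_le_mul_left this hN
  have hind : ∀ j ≤ l + 1, ∃ H : AddSubgroup V, 32 * t ^ 2 * H.index ≤ towerTop p t (j + 2) ∧
      Fintype.card V * (α ^ 3 + (2 ^ j - 1) * (ε / 2)) ≤ ∑ x, ag H f x ^ 3 := by
    intro j
    induction j with
    | zero =>
      intro _
      refine ⟨⊤, ?_, ?_⟩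
      · rw [AddSubgroup.index_top, mul_one]
        exact base_tower p t hp ht1
      · have : ∀ x, ag ⊤ f x = α := by
          intro x
          unfold ag
          have e : ∑ k : (⊤ : AddSubgroup V), f (x + k) = ∑ x, f x := by
            rw [← Equiv.sum_comp (Equiv.addLeft x) f]
            exact Equiv.sum_comp (AddSubgroup.topEquiv (G := V)).toEquiv (fun k => f (x + k))
          rw [e, hα, AddSubgroup.card_top, Nat.card_eq_fintype_card]
          field_simp
        simp [this]
    | succ j ih =>
      intro hj
      obtain ⟨H, hH1, hH2⟩ := ih (by omega)
      have hm : 1 ≤ ((16 * t ^ 2 : ℕ) : ℝ) * (ε / 4) ^ 2 := by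
        push_cast
        have : 1 ≤ (t * ε) ^ 2 := one_le_pow₀ hte
        nlinarith
      obtain ⟨H', hi, hs⟩ := step p (by omega) hV hb f hf hf1 (ε / 4) (by positivity)
        (16 * t ^ 2) hm H
      refine ⟨H', ?_, ?_⟩
      · have h1 : towerTop p t (j + 1 + 2) = p ^ towerTop p t (j + 2) := rfl
        rw [h1]
        refine le_trans ?_ (Nat.pow_le_pow_right (by omega) hH1)
        calc 32 * t ^ 2 * H'.index ≤ 32 * t ^ 2 * (H.index * p ^ (H.index * (16 * t ^ 2))) :=
              Nat.mul_le_mul_left _ hi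
          _ = 2 * (H.index * (16 * t ^ 2)) * p ^ (H.index * (16 * t ^ 2)) := by ring
          _ ≤ p ^ (H.index * (16 * t ^ 2)) * p ^ (H.index * (16 * t ^ 2)) :=
              Nat.mul_le_mul_right _ (two_mul_le_pow p hp _)
          _ = p ^ (32 * t ^ 2 * H.index) := by rw [← pow_add]; congr 1; ring
      · have hcard : 32 * t ^ 2 ≤ Nat.card H := by
          have h1 : 32 * t ^ 2 * H.index ≤ Nat.card H * H.index := by
            rw [AddSubgroup.card_mul_index, Nat.card_eq_fintype_card]
            exact hH1.trans ((tower_mono p t (by omega) (by omega)).trans hn)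
          exact Nat.le_of_mul_le_mul_right h1 (Nat.pos_of_ne_zero AddSubgroup.index_ne_zero_of_finite)
        have hcard' : 8 ≤ (Nat.card H : ℝ) * ε := by
          have h1 : 8 * t ≤ Nat.card H := by nlinarith
          have h2 : (8 * t : ℝ) ≤ Nat.card H := by exact_mod_cast h1
          nlinarith
        have hHpos : (0:ℝ) < Nat.card H := by exact_mod_cast Nat.card_pos
        have hD := sum_D (fun d => ∑ x, f x * f (x + d) * f (x + (d + d))) H (Fintype.card V)
          (α ^ 3 - ε) (by
            refine (Finset.sum_le_sum (g := fun _ => (1:ℝ)) fun x _ => ?_).trans (by simp)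
            simp only [add_zero]
            exact mul_le_one₀ (mul_le_one₀ (hf1 x) (hf x) (hf1 x)) (hf x) (hf1 x)) hN.le
            (by have : 0 ≤ α ^ 3 := by positivity
                linarith) (fun d hd => (hcon d hd).le)
        rw [Finset.sum_comm] at hD
        have h3 := hs.trans hD
        have h4 : (Nat.card H : ℝ) * (Fintype.card V * (α ^ 3 - ε)) + 2 * Fintype.card V ≤
            (Nat.card H : ℝ) * (Fintype.card V * (α ^ 3 - ε) + Fintype.card V * (ε / 4)) := by
          nlinarith
        have h5 := le_of_mul_le_mul_left (h3.trans h4) hHpos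
        rw [pow_succ (2:ℝ)]
        nlinarith
  obtain ⟨H, -, hH⟩ := hind (l + 1) le_rfl
  have hup : ∑ x, ag H f x ^ 3 ≤ Fintype.card V * α := by
    rw [← hα, ← sum_ag H f]
    refine Finset.sum_le_sum fun x _ => ?_
    exact pow_le_of_le_one (ag_nonneg H f hf x) (ag_le H f hf1 x) (by norm_num)
  have h1 := le_of_mul_le_mul_left (hH.trans hup) hN
  have h2 : 1 < 2 ^ (l + 1) * ε := by
    have h : Real.logb 2 (1 / ε) < (l + 1 : ℕ) := by
      push_cast; exact Nat.lt_floor_add_one _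
    rw [Real.logb_lt_iff_lt_rpow (by norm_num) (by positivity), Real.rpow_natCast,
      div_lt_iff₀ hε0] at h
    exact h
  have h3 : α - α ^ 3 < 0.39 := by
    nlinarith [mul_nonneg (sq_nonneg (α - 0.577)) (by linarith : 0 ≤ α + 2 * 0.577)]
  nlinarith
end

end

/-- Upper bound for sets. Let `p` be an odd prime and `0 < ε < 1/5`.
If `n` is at least an exponential tower of `p`'s of height `⌊log₂(1/ε)⌋ + 5` with a
`⌈1/ε⌉` on top, then for every subset `A ⊆ 𝔽_p^n` with density `α = |A|/p^n` there is
a nonzero `d ∈ 𝔽_p^n` such that the density of 3-APs with common difference `d` of `A`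
is at least `α³ - ε`. -/
theorem upper_bound_sets (p : ℕ) [Fact p.Prime] (hodd : Odd p) (ε : ℝ)
    (hε0 : 0 < ε) (hε : ε < 1 / 5) (n : ℕ)
    (hn : towerTop p ⌈1 / ε⌉₊ (⌊Real.logb 2 (1 / ε)⌋₊ + 5) ≤ n)
    (A : Finset (Fin n → ZMod p)) :
    ∃ d : Fin n → ZMod p, d ≠ 0 ∧
      (((Finset.univ.filter fun x : Fin n → ZMod p =>
            x ∈ A ∧ x + d ∈ A ∧ x + 2 • d ∈ A).card : ℝ) / (p : ℝ) ^ n ≥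
        ((A.card : ℝ) / (p : ℝ) ^ n) ^ 3 - ε) := by
  have hp := (Fact.out : p.Prime)
  have hp3 : 3 ≤ p := by
    have := hp.two_le
    rcases hodd with ⟨k, hk⟩
    omega
  have hcard : Fintype.card (Fin n → ZMod p) = p ^ n := by simp [ZMod.card]
  have hpn : (0:ℝ) < (p:ℝ) ^ n := by
    have : (0:ℝ) < p := by exact_mod_cast hp.pos
    positivity
  have hV : ∀ g : Fin n → ZMod p, p • g = 0 := by
    intro g; funext i; simp
  have hb : Function.Injective (fun d : Fin n → ZMod p => d + d) := by
    intro a b h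
    obtain ⟨k, hk⟩ := hodd
    have e : ∀ a : Fin n → ZMod p, (k + 1) • (a + a) = a := by
      intro a
      have : (k + 1) • (a + a) = (2 * k + 1) • a + a := by
        rw [← two_nsmul, ← mul_nsmul, ← succ_nsmul]
        congr 1
      rw [this, ← hk, hV, zero_add]
    rw [← e a, ← e b]
    exact congrArg _ h
  obtain ⟨d, hd, h⟩ := main_aux p hp3 hV hb (fun x => if x ∈ A then (1:ℝ) else 0)
    (fun x => by split_ifs <;> norm_num) (fun x => by split_ifs <;> norm_num) ε hε0 hε
    ((A.card : ℝ) / (p : ℝ) ^ n) (by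
      rw [hcard]; push_cast
      field_simp
      simp) (by
      rw [hcard]
      exact hn.trans (Nat.lt_pow_self hp.one_lt).le)
  refine ⟨d, hd, ?_⟩
  rw [ge_iff_le, le_div_iff₀ hpn, mul_comm]
  rw [hcard] at h
  push_cast at h
  refine h.trans (le_of_eq ?_)
  rw [Finset.card_filter]
  push_cast
  refine Finset.sum_congr rfl fun x _ => ?_
  rw [two_nsmul]
  by_cases h1 : x ∈ A <;> by_cases h2 : x + d ∈ A <;> by_cases h3 : x + (d + d) ∈ A <;>
    simp [h1, h2, h3]
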